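/- Dual construction equivalence: with 𝒵_t and 𝒲_t as in the primal construction, define Z_t(x) = sup{xᵀz : z ∈ −𝒵_t} and W_t(x) = sup{xᵀz : z ∈ −𝒲_t}, and U(x) = −xᵀξ. Then at each terminal node ω, Z_T^ω equals U^ω on the dual cone 𝒦_T^{+ω} and +∞ elsewhere; and for t < T and any node ω ∈ Ω_t, W_t^ω = conv{Z_{t+1}^{ω'} : ω' ∈ succ(ω)} (the convex hull of the functions Z_{t+1}^{ω'}), and Z_t^ω equals W_t^ω on 𝒦_t^{+ω} and +∞ elsewhere. -/

import Mathlib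

open Matrix Pointwise

/-- Support function of a set `A ⊆ ℝⁿ`, with values in the extended reals. -/
noncomputable def suppF {n : ℕ} (A : Set (Fin n → ℝ)) (x : Fin n → ℝ) : EReal :=
  sSup ((fun z => ((x ⬝ᵥ z : ℝ) : EReal)) '' A)


/-- Polyhedral set: finite intersection of closed half-spaces. -/
def IsPolyh {E : Type} [AddCommGroup E] [Module ℝ E] (P : Set E) : Prop :=
  ∃ s : Finset ((E →ₗ[ℝ] ℝ) × ℝ), P = {z | ∀ a ∈ s, a.1 z ≤ a.2}

theorem between_exists {ι : Type} (L U : Finset ι) (l u : ι → ℝ)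
    (h0 : ∀ j ∈ U, 0 ≤ u j) (h : ∀ i ∈ L, ∀ j ∈ U, l i ≤ u j) :
    ∃ s : ℝ, 0 ≤ s ∧ (∀ i ∈ L, l i ≤ s) ∧ (∀ j ∈ U, s ≤ u j) := by
  classical
  have hne : (insert (0:ℝ) (L.image l)).Nonempty := ⟨0, by simp⟩
  refine ⟨(insert (0:ℝ) (L.image l)).max' hne, ?_, ?_, ?_⟩
  · exact Finset.le_max' _ _ (by simp)
  · intro i hi
    exact Finset.le_max' _ _ (by simp only [Finset.mem_insert, Finset.mem_image]; exact Or.inr ⟨i, hi, rfl⟩)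
  · intro j hj
    apply Finset.max'_le
    intro y hy
    simp only [Finset.mem_insert, Finset.mem_image] at hy
    rcases hy with rfl | ⟨i, hi, rfl⟩
    · exact h0 j hj
    · exact h i hi j hj

theorem IsPolyh.ray {E : Type} [AddCommGroup E] [Module ℝ E] {P : Set E} (hP : IsPolyh P)
    (v : E) : IsPolyh {z | ∃ s : ℝ, 0 ≤ s ∧ z - s • v ∈ P} := by
  classical
  obtain ⟨S, rfl⟩ := hP
  refine ⟨S.filter (fun a => a.1 v ≤ 0) ∪
    ((S.filter (fun a => 0 < a.1 v)) ×ˢ (S.filter (fun a => a.1 v < 0))).image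
      (fun pq => (pq.1.1 v) • pq.2 - (pq.2.1 v) • pq.1), ?_⟩
  ext z
  simp only [Set.mem_ofPred_eq, map_sub, map_smul, smul_eq_mul]
  constructor
  · rintro ⟨s, hs, h⟩ a ha
    simp only [Finset.mem_union, Finset.mem_filter, Finset.mem_image, Finset.mem_product] at ha
    rcases ha with ⟨ha, hv⟩ | ⟨⟨p, q⟩, ⟨⟨hp, hpv⟩, ⟨hq, hqv⟩⟩, rfl⟩
    · have := h a ha
      nlinarith
    · have h1 := h p hp
      have h2 := h q hq
      simp only [Prod.fst_sub, Prod.snd_sub, Prod.smul_fst, Prod.smul_snd, LinearMap.sub_apply,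
        LinearMap.smul_apply, smul_eq_mul] at *
      nlinarith [mul_le_mul_of_nonneg_left h2 hpv.le,
        mul_le_mul_of_nonneg_left h1 (neg_nonneg.2 hqv.le)]
  · intro h
    obtain ⟨s, hs, hl, hu⟩ := between_exists (S.filter (fun a => 0 < a.1 v))
      (S.filter (fun a => a.1 v < 0)) (fun a => (a.1 z - a.2) / a.1 v)
      (fun a => (a.1 z - a.2) / a.1 v) (by
        intro j hj
        simp only [Finset.mem_filter] at hj
        have := h j (by simp [hj.1, hj.2.le])
        exact div_nonneg_of_nonpos (by linarith) hj.2.le) (by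
        intro p hp q hq
        have := h (p.1 v • q - q.1 v • p) (by
          refine Finset.mem_union_right _ (Finset.mem_image.2 ⟨(p, q), ?_, rfl⟩)
          exact Finset.mem_product.2 ⟨hp, hq⟩)
        simp only [Finset.mem_filter] at hp hq
        simp only [Prod.fst_sub, Prod.snd_sub, Prod.smul_fst, Prod.smul_snd, LinearMap.sub_apply,
          LinearMap.smul_apply, smul_eq_mul] at this
        have hpv := hp.2
        have hqv := hq.2
        rw [div_le_iff₀ hpv, div_mul_eq_mul_div, le_div_iff_of_neg hqv]
        nlinarith)
    refine ⟨s, hs, fun a ha => ?_⟩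
    rcases lt_trichotomy (a.1 v) 0 with hv | hv | hv
    · have := hu a (by simp [ha, hv])
      rw [le_div_iff_of_neg hv] at this
      linarith
    · have := h a (by simp [ha, hv.le])
      rw [hv]; linarith
    · have := hl a (by simp [ha, hv])
      rw [div_le_iff₀ hv] at this
      linarith

theorem IsPolyh.cone {E : Type} [AddCommGroup E] [Module ℝ E] {P : Set E} (hP : IsPolyh P)
    {ι : Type} (v : ι → E) (s : Finset ι) :
    IsPolyh {z | ∃ c : ι → ℝ, (∀ i, 0 ≤ c i) ∧ z - ∑ i ∈ s, c i • v i ∈ P} := by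
  classical
  induction s using Finset.induction_on with
  | empty =>
    convert hP using 1
    ext z
    simp only [Finset.sum_empty, sub_zero, Set.mem_ofPred_eq]
    exact ⟨fun ⟨_, _, h⟩ => h, fun h => ⟨fun _ => 0, fun _ => le_rfl, h⟩⟩
  | insert i s hi ih =>
    convert ih.ray (v i) using 1
    ext z
    simp only [Set.mem_ofPred_eq]
    constructor
    · rintro ⟨c, hc, h⟩
      refine ⟨c i, hc i, c, hc, ?_⟩
      rw [Finset.sum_insert hi] at h
      rwa [sub_sub]
    · rintro ⟨r, hr, c, hc, h⟩
      refine ⟨Function.update c i r, ?_, ?_⟩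
      · intro j
        by_cases hj : j = i
        · subst hj; simpa using hr
        · simpa [hj] using hc j
      · rw [Finset.sum_insert hi, Function.update_self]
        rw [sub_sub] at h
        have : ∑ x ∈ s, Function.update c i r x • v x = ∑ x ∈ s, c x • v x := by
          apply Finset.sum_congr rfl
          intro x hx
          rw [Function.update_of_ne]
          rintro rfl; exact hi hx
        rwa [this]

theorem IsPolyh.singleton {E : Type} [AddCommGroup E] [Module ℝ E] [FiniteDimensional ℝ E]
    (x : E) : IsPolyh {x} := by
  classical
  let b := Module.finBasis ℝ E
  refine ⟨Finset.univ.image (fun i => (b.coord i, b.coord i x)) ∪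
    Finset.univ.image (fun i => (-b.coord i, -b.coord i x)), ?_⟩
  ext z
  simp only [Set.mem_singleton_iff, Set.mem_ofPred_eq]
  constructor
  · rintro rfl a ha
    simp only [Finset.mem_union, Finset.mem_image] at ha
    rcases ha with ⟨i, _, rfl⟩ | ⟨i, _, rfl⟩ <;> simp
  · intro h
    apply b.ext_elem
    intro i
    have h1 := h (b.coord i, b.coord i x) (
      Finset.mem_union_left _ (Finset.mem_image.2 ⟨i, Finset.mem_univ _, rfl⟩))
    have h2 := h (-b.coord i, -b.coord i x) (
      Finset.mem_union_right _ (Finset.mem_image.2 ⟨i, Finset.mem_univ _, rfl⟩))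
    simp at h1 h2
    linarith

theorem IsPolyh.biInter {E : Type} [AddCommGroup E] [Module ℝ E] {ι : Type} (s : Finset ι)
    (A : ι → Set E) (h : ∀ i ∈ s, IsPolyh (A i)) : IsPolyh (⋂ i ∈ s, A i) := by
  classical
  induction s using Finset.induction_on with
  | empty => exact ⟨∅, by simp⟩
  | insert i s hi ih =>
    obtain ⟨S, hS⟩ := ih (fun j hj => h j (Finset.mem_insert_of_mem hj))
    obtain ⟨R, hR⟩ := h i (Finset.mem_insert_self _ _)
    refine ⟨R ∪ S, ?_⟩
    rw [Finset.set_biInter_insert, hS, hR]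
    ext z
    simp only [Set.mem_inter_iff, Set.mem_ofPred_eq, Finset.mem_union]
    exact ⟨fun ⟨h1, h2⟩ a ha => ha.elim (h1 a) (h2 a),
      fun h => ⟨fun a ha => h a (Or.inl ha), fun a ha => h a (Or.inr ha)⟩⟩

/-- Affine Farkas lemma. -/
theorem affine_farkas {d : ℕ} {J : Type} (s : Finset J) (a : J → Fin d → ℝ) (b : J → ℝ)
    (z0 : Fin d → ℝ) (hz0 : ∀ j ∈ s, a j ⬝ᵥ z0 ≤ b j) (x : Fin d → ℝ) (c : ℝ)
    (h : ∀ z, (∀ j ∈ s, a j ⬝ᵥ z ≤ b j) → x ⬝ᵥ z ≤ c) :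
    ∃ y : J → ℝ, (∀ j, 0 ≤ y j) ∧ ∑ j ∈ s, y j • a j = x ∧ ∑ j ∈ s, y j * b j ≤ c := by
  classical
  let v : Option J → (Fin d → ℝ) × ℝ := fun o => o.elim (0, 1) (fun j => (a j, b j))
  obtain ⟨S, hS⟩ := (IsPolyh.singleton (0 : (Fin d → ℝ) × ℝ)).cone v (Finset.insertNone s)
  have key : (x, c) ∈ {z : (Fin d → ℝ) × ℝ | ∃ c : Option J → ℝ, (∀ i, 0 ≤ c i) ∧
      z - ∑ i ∈ Finset.insertNone s, c i • v i ∈ ({0} : Set ((Fin d → ℝ) × ℝ))} := by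
    by_contra hn
    have hcone : ∀ o ∈ Finset.insertNone s, ∀ r : ℝ, 0 ≤ r → r • v o ∈
        {z : (Fin d → ℝ) × ℝ | ∃ c : Option J → ℝ, (∀ i, 0 ≤ c i) ∧
      z - ∑ i ∈ Finset.insertNone s, c i • v i ∈ ({0} : Set ((Fin d → ℝ) × ℝ))} := by
      intro o ho r hr
      refine ⟨Pi.single o r, ?_, ?_⟩
      · intro i
        by_cases hi : i = o
        · subst hi; simpa using hr
        · simp [hi]
      · rw [Finset.sum_eq_single o]
        · simp
        · intro i _ hi; simp [hi]
        · intro h; exact absurd ho h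
    rw [hS] at hn hcone
    simp only [Set.mem_ofPred_eq, not_forall, not_le] at hn hcone
    obtain ⟨φ, hφ, hlt⟩ := hn
    have hnn : ∀ o ∈ Finset.insertNone s, φ.1 (v o) ≤ 0 := by
      intro o ho
      by_contra hpos
      push Not at hpos
      have h1 := hcone o ho ((|φ.2| + 1) / φ.1 (v o)) (by positivity) φ hφ
      rw [map_smul, smul_eq_mul, div_mul_cancel₀ _ hpos.ne'] at h1
      linarith [le_abs_self φ.2]
    have h0 : 0 ≤ φ.2 := by
      have := hcone none (by simp) 0 le_rfl φ hφ
      simpa using this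
    let p : Fin d → ℝ := fun k => φ.1 (Pi.single k 1, 0)
    let q : ℝ := - φ.1 (0, 1)
    have hrep : ∀ (w : Fin d → ℝ) (r : ℝ), φ.1 (w, r) = w ⬝ᵥ p - q * r := by
      intro w r
      have : (w, r) = ∑ k, w k • ((Pi.single k 1, 0) : (Fin d → ℝ) × ℝ) + r • ((0:Fin d → ℝ), (1:ℝ)) := by
        ext1
        · simp only [Prod.fst_add, Prod.fst_sum, Prod.smul_fst, smul_zero, add_zero]
          ext k
          simp [Finset.sum_apply, Pi.single_apply]
        · simp [Prod.snd_sum]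
      rw [this, map_add, map_sum]
      simp only [map_smul, smul_eq_mul, dotProduct, p, q]
      ring
    have hq : 0 ≤ q := by
      have := hnn none (by simp)
      simp only [v, Option.elim] at this
      simp only [q]; linarith
    have ha : ∀ j ∈ s, a j ⬝ᵥ p ≤ q * b j := by
      intro j hj
      have := hnn (some j) (by simpa using hj)
      simp only [v, Option.elim, hrep] at this
      linarith
    rw [hrep] at hlt
    rcases hq.eq_or_lt with hq0 | hq0
    · have hpx : 0 < x ⬝ᵥ p := by rw [← hq0] at hlt; linarith
      have := h (z0 + ((|c - x ⬝ᵥ z0| + 1) / (x ⬝ᵥ p)) • p) (by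
        intro j hj
        have h1 := ha j hj
        rw [← hq0, zero_mul] at h1
        rw [dotProduct_add, dotProduct_smul, smul_eq_mul]
        have h2 : 0 ≤ (|c - x ⬝ᵥ z0| + 1) / (x ⬝ᵥ p) := by positivity
        have := hz0 j hj
        nlinarith)
      rw [dotProduct_add, dotProduct_smul, smul_eq_mul, div_mul_cancel₀ _ hpx.ne'] at this
      linarith [le_abs_self (c - x ⬝ᵥ z0)]
    · have := h (q⁻¹ • p) (by
        intro j hj
        have h1 := ha j hj
        rw [dotProduct_smul, smul_eq_mul, inv_mul_le_iff₀ hq0]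
        exact h1)
      rw [dotProduct_smul, smul_eq_mul, inv_mul_le_iff₀ hq0] at this
      linarith
  obtain ⟨y, hy, he⟩ := key
  rw [Set.mem_singleton_iff, sub_eq_zero, Finset.sum_insertNone] at he
  have e1 := congrArg Prod.fst he
  have e2 := congrArg Prod.snd he
  simp only [Prod.fst_add, Prod.fst_sum, Prod.snd_add, Prod.snd_sum, v, Option.elim, Prod.smul_fst,
    Prod.smul_snd, smul_zero, zero_add, smul_eq_mul, mul_one] at e1 e2
  exact ⟨fun j => y (some j), fun j => hy _, e1.symm, by linarith [hy none]⟩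

/-- Decomposition of a valid inequality over an intersection of polyhedra. -/
theorem inter_decomp {d : ℕ} {ι : Type} (I : Finset ι) (A : ι → Set (Fin d → ℝ))
    (hA : ∀ i ∈ I, IsPolyh (A i)) (z0 : Fin d → ℝ) (hz0 : ∀ i ∈ I, z0 ∈ A i)
    (x : Fin d → ℝ) (c : ℝ) (h : ∀ z, (∀ i ∈ I, z ∈ A i) → x ⬝ᵥ z ≤ c) :
    ∃ (xs : ι → Fin d → ℝ) (cs : ι → ℝ), (∀ i ∈ I, ∀ z ∈ A i, xs i ⬝ᵥ z ≤ cs i) ∧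
      ∑ i ∈ I, xs i = x ∧ ∑ i ∈ I, cs i ≤ c := by
  classical
  have hA' : ∀ i, ∃ s : Finset (((Fin d → ℝ) →ₗ[ℝ] ℝ) × ℝ), i ∈ I → A i = {z | ∀ a ∈ s, a.1 z ≤ a.2} := by
    intro i
    by_cases hi : i ∈ I
    · obtain ⟨s, hs⟩ := hA i hi
      exact ⟨s, fun _ => hs⟩
    · exact ⟨∅, fun h => absurd h hi⟩
  choose S hS using hA'
  let vec : ((Fin d → ℝ) →ₗ[ℝ] ℝ) → Fin d → ℝ := fun f k => f (Pi.single k 1)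
  have hvec : ∀ f z, vec f ⬝ᵥ z = f z := by
    intro f z
    conv_rhs => rw [pi_eq_sum_univ' z]
    rw [map_sum]
    simp only [map_smul, dotProduct, vec, smul_eq_mul]
    refine Finset.sum_congr rfl fun k _ => ?_
    rw [mul_comm]
  obtain ⟨y, hy, h1, h2⟩ := affine_farkas (I.sigma S) (fun j => vec j.2.1) (fun j => j.2.2) z0
    (by
      rintro ⟨i, a⟩ hj
      rw [Finset.mem_sigma] at hj
      have := hz0 i hj.1
      rw [hS i hj.1] at this
      simpa [hvec] using this a hj.2) x c
    (by
      intro z hz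
      apply h
      intro i hi
      rw [hS i hi]
      intro a ha
      simpa [hvec] using hz ⟨i, a⟩ (Finset.mem_sigma.2 ⟨hi, ha⟩))
  rw [Finset.sum_sigma] at h1 h2
  refine ⟨fun i => ∑ a ∈ S i, y ⟨i, a⟩ • vec a.1, fun i => ∑ a ∈ S i, y ⟨i, a⟩ * a.2, ?_, h1, h2⟩
  intro i hi z hz
  rw [hS i hi] at hz
  rw [sum_dotProduct]
  apply Finset.sum_le_sum
  intro a ha
  rw [smul_dotProduct, hvec, smul_eq_mul]
  exact mul_le_mul_of_nonneg_left (hz a ha) (hy _)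

theorem ereal_coe_sum {ι : Type} (s : Finset ι) (f : ι → ℝ) :
    ((∑ i ∈ s, f i : ℝ) : EReal) = ∑ i ∈ s, (f i : EReal) := by
  classical
  induction s using Finset.induction_on with
  | empty => simp
  | insert i s hi ih => rw [Finset.sum_insert hi, Finset.sum_insert hi, EReal.coe_add, ih]

theorem suppF_neg_le {n : ℕ} (A : Set (Fin n → ℝ)) (x : Fin n → ℝ) (c : EReal) :
    suppF (-A) x ≤ c ↔ ∀ z ∈ A, ((-(x ⬝ᵥ z) : ℝ) : EReal) ≤ c := by
  unfold suppF
  rw [sSup_le_iff]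
  constructor
  · intro h z hz
    apply h
    exact ⟨-z, by simpa using hz, by simp [dotProduct_neg]⟩
  · rintro h _ ⟨z, hz, rfl⟩
    have := h (-z) hz
    simpa [dotProduct_neg] using this

theorem le_suppF_neg {n : ℕ} {A : Set (Fin n → ℝ)} (x : Fin n → ℝ) {z : Fin n → ℝ} (hz : z ∈ A) :
    ((-(x ⬝ᵥ z) : ℝ) : EReal) ≤ suppF (-A) x :=
  (suppF_neg_le A x _).1 le_rfl z hz

theorem suppF_add_cone {n : ℕ} (A K : Set (Fin n → ℝ)) (x : Fin n → ℝ) (h0 : (0 : Fin n → ℝ) ∈ K)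
    (h : ∀ k ∈ K, 0 ≤ x ⬝ᵥ k) : suppF (-(A + K)) x = suppF (-A) x := by
  apply le_antisymm
  · rw [suppF_neg_le]
    rintro _ ⟨a, ha, k, hk, rfl⟩
    refine le_trans ?_ (le_suppF_neg x ha)
    rw [EReal.coe_le_coe_iff]
    simp only [dotProduct_add]
    linarith [h k hk]
  · rw [suppF_neg_le]
    intro a ha
    exact le_suppF_neg x ⟨a, ha, 0, h0, add_zero a⟩

theorem suppF_add_cone_top {n : ℕ} (A K : Set (Fin n → ℝ)) (x : Fin n → ℝ) (hA : A.Nonempty)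
    (hK : ∀ r : ℝ, 0 ≤ r → ∀ k ∈ K, r • k ∈ K)
    (h : ¬ ∀ k ∈ K, 0 ≤ x ⬝ᵥ k) : suppF (-(A + K)) x = ⊤ := by
  push Not at h
  obtain ⟨k, hk, hlt⟩ := h
  obtain ⟨a, ha⟩ := hA
  rw [EReal.eq_top_iff_forall_lt]
  intro y
  have hr : 0 ≤ (|y + x ⬝ᵥ a| + 1) / (-(x ⬝ᵥ k)) := div_nonneg (by positivity) (by linarith)
  refine lt_of_lt_of_le ?_ (le_suppF_neg x ⟨a, ha, _, hK _ hr k hk, rfl⟩)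
  rw [EReal.coe_lt_coe_iff]
  simp only [dotProduct_add, dotProduct_smul, smul_eq_mul]
  have : (|y + x ⬝ᵥ a| + 1) / (-(x ⬝ᵥ k)) * (x ⬝ᵥ k) = -(|y + x ⬝ᵥ a| + 1) := by
    rw [div_neg, neg_mul, div_mul_cancel₀ _ hlt.ne]
  rw [this]
  linarith [le_abs_self (y + x ⬝ᵥ a)]

/-- dual construction equivalence. With `Z_t`, `W_t` the support
functions of `−𝒵_t`, `−𝒲_t` from the primal construction in the Kabanov model
(solvency cones generated by `e¹,…,e^d` and `π jk • eʲ − eᵏ`): at a terminal node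
`Z_T = U = −⟨·,ξ⟩` on the dual cone `𝒦_T⁺` and `+∞` elsewhere; for `t < T`,
`W_t` is the convex hull of the functions `Z_{t+1}^{ω'}` over the successors `ω'`
(given by the infimal convex-combination formula), and `Z_t = W_t` on `𝒦_t⁺`
and `+∞` elsewhere. -/
theorem stmt10 (d T : ℕ) (Ω : Type) [Fintype Ω] [DecidableEq Ω]
    (part : ℕ → Ω → Finset Ω)
    (hmem : ∀ t ω, ω ∈ part t ω)
    (hcong : ∀ t ω ω', ω' ∈ part t ω → part t ω' = part t ω)
    (hrefine : ∀ t ω, part (t + 1) ω ⊆ part t ω)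
    (hpart0 : ∀ ω, part 0 ω = Finset.univ)
    (hpartT : ∀ ω, part T ω = {ω})
    (π : ℕ → Ω → Fin d → Fin d → ℝ)
    (hπpos : ∀ t ω j k, 0 < π t ω j k) (hπdiag : ∀ t ω j, π t ω j j = 1)
    (hπadapt : ∀ t ω ω', ω' ∈ part t ω → π t ω' = π t ω)
    (𝒦 : ℕ → Ω → Set (Fin d → ℝ))
    (h𝒦 : ∀ t ω, 𝒦 t ω = {x | ∃ (μ : Fin d → ℝ) (β : Fin d → Fin d → ℝ),
      (∀ k, 0 ≤ μ k) ∧ (∀ j k, 0 ≤ β j k) ∧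
      x = (∑ k, μ k • (Pi.single k 1 : Fin d → ℝ))
        + ∑ j, ∑ k, β j k • (π t ω j k • (Pi.single j 1 : Fin d → ℝ)
            - (Pi.single k 1 : Fin d → ℝ))})
    (ξ : Ω → Fin d → ℝ)
    (𝒵 𝒲 : ℕ → Ω → Set (Fin d → ℝ))
    (hZT : ∀ ω, 𝒵 T ω = {ξ ω} + 𝒦 T ω)
    (hW : ∀ t, t < T → ∀ ω, 𝒲 t ω = ⋂ ω' ∈ part t ω, 𝒵 (t + 1) ω')
    (hZrec : ∀ t, t < T → ∀ ω, 𝒵 t ω = 𝒲 t ω + 𝒦 t ω)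
    (Z W : ℕ → Ω → (Fin d → ℝ) → EReal)
    (hZdef : ∀ t ω, Z t ω = suppF (-(𝒵 t ω)))
    (hWdef : ∀ t ω, W t ω = suppF (-(𝒲 t ω))) :
    (∀ ω, ∀ x : Fin d → ℝ,
      ((∀ k ∈ 𝒦 T ω, 0 ≤ x ⬝ᵥ k) → Z T ω x = ((-(x ⬝ᵥ ξ ω) : ℝ) : EReal)) ∧
      (¬(∀ k ∈ 𝒦 T ω, 0 ≤ x ⬝ᵥ k) → Z T ω x = ⊤)) ∧
    (∀ t, t < T → ∀ ω, ∀ x : Fin d → ℝ,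
      W t ω x = sInf {r : EReal | ∃ (lam : Ω → ℝ) (xs : Ω → Fin d → ℝ),
        (∀ ω', 0 ≤ lam ω') ∧ (∀ ω' ∉ part t ω, lam ω' = 0) ∧
        (∑ ω', lam ω') = 1 ∧ (∑ ω', lam ω' • xs ω') = x ∧
        r = ∑ ω', ((lam ω' : EReal) * Z (t + 1) ω' (xs ω'))}) ∧
    (∀ t, t < T → ∀ ω, ∀ x : Fin d → ℝ,
      ((∀ k ∈ 𝒦 t ω, 0 ≤ x ⬝ᵥ k) → Z t ω x = W t ω x) ∧
      (¬(∀ k ∈ 𝒦 t ω, 0 ≤ x ⬝ᵥ k) → Z t ω x = ⊤)) := by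
  classical
  -- generators of the cone
  let gen : ℕ → Ω → (Fin d ⊕ (Fin d × Fin d)) → Fin d → ℝ := fun t ω =>
    Sum.elim (fun k => Pi.single k 1) (fun jk => π t ω jk.1 jk.2 • (Pi.single jk.1 1 : Fin d → ℝ)
            - (Pi.single jk.2 1 : Fin d → ℝ))
  have hgen : ∀ t ω x, x ∈ 𝒦 t ω ↔ ∃ c : (Fin d ⊕ (Fin d × Fin d)) → ℝ, (∀ i, 0 ≤ c i) ∧
      x = ∑ i, c i • gen t ω i := by
    intro t ω x
    rw [h𝒦]
    simp only [Set.mem_ofPred_eq, Fintype.sum_sum_type, Fintype.sum_prod_type, gen, Sum.elim_inl,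
      Sum.elim_inr]
    constructor
    · rintro ⟨μ, β, hμ, hβ, rfl⟩
      exact ⟨Sum.elim μ (fun jk => β jk.1 jk.2), by rintro (k | jk); exacts [hμ k, hβ _ _], rfl⟩
    · rintro ⟨c, hc, rfl⟩
      exact ⟨fun k => c (Sum.inl k), fun j k => c (Sum.inr (j, k)), fun k => hc _,
        fun j k => hc _, rfl⟩
  have hK0 : ∀ t ω, (0 : Fin d → ℝ) ∈ 𝒦 t ω := fun t ω =>
    (hgen t ω 0).2 ⟨fun _ => 0, fun _ => le_rfl, by simp⟩
  have hKsmul : ∀ t ω, ∀ r : ℝ, 0 ≤ r → ∀ k ∈ 𝒦 t ω, r • k ∈ 𝒦 t ω := by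
    intro t ω r hr k hk
    obtain ⟨c, hc, rfl⟩ := (hgen t ω k).1 hk
    exact (hgen t ω _).2 ⟨fun i => r * c i, fun i => mul_nonneg hr (hc i), by
      simp [Finset.smul_sum, mul_smul]⟩
  have hKpos : ∀ t ω (x : Fin d → ℝ), (∀ k, 0 ≤ x k) → x ∈ 𝒦 t ω := by
    intro t ω x hx
    rw [h𝒦]
    refine ⟨x, fun _ _ => 0, hx, fun _ _ => le_rfl, ?_⟩
    ext k
    simp [Finset.sum_apply, Pi.single_apply]
  have hsum : ∀ t ω P, IsPolyh P → IsPolyh (P + 𝒦 t ω) := by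
    intro t ω P hP
    convert hP.cone (gen t ω) Finset.univ using 1
    ext z
    rw [Set.mem_add]
    constructor
    · rintro ⟨a, ha, k, hk, rfl⟩
      obtain ⟨c, hc, rfl⟩ := (hgen t ω k).1 hk
      exact ⟨c, hc, by simpa using ha⟩
    · rintro ⟨c, hc, h⟩
      exact ⟨_, h, _, (hgen t ω _).2 ⟨c, hc, rfl⟩, by simp⟩
  have hWgood : ∀ t, t < T → (∀ ω, IsPolyh (𝒵 (t + 1) ω) ∧ ∃ M : ℝ, ∀ z : Fin d → ℝ, (∀ k, M ≤ z k) → z ∈ 𝒵 (t + 1) ω) →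
      ∀ ω, IsPolyh (𝒲 t ω) ∧ ∃ M : ℝ, ∀ z : Fin d → ℝ, (∀ k, M ≤ z k) → z ∈ 𝒲 t ω := by
    intro t ht h ω
    rw [hW t ht]
    refine ⟨IsPolyh.biInter _ _ (fun i _ => (h i).1), ?_⟩
    choose M hM using fun ω => (h ω).2
    refine ⟨∑ ω, |M ω|, fun z hz => ?_⟩
    simp only [Set.mem_iInter]
    intro i _
    apply hM i
    intro k
    exact ((le_abs_self _).trans (Finset.single_le_sum (f := fun ω => |M ω|)
      (fun _ _ => abs_nonneg _) (Finset.mem_univ i))).trans (hz k)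
  have hgood : ∀ n, n ≤ T → ∀ ω, IsPolyh (𝒵 (T - n) ω) ∧
      ∃ M : ℝ, ∀ z : Fin d → ℝ, (∀ k, M ≤ z k) → z ∈ 𝒵 (T - n) ω := by
    intro n
    induction n with
    | zero =>
      intro _ ω
      rw [Nat.sub_zero, hZT]
      refine ⟨hsum _ _ _ (IsPolyh.singleton _), ∑ k, |ξ ω k|, fun z hz => ?_⟩
      refine ⟨ξ ω, rfl, z - ξ ω, hKpos _ _ _ (fun k => ?_), by simp⟩
      have := ((le_abs_self _).trans (Finset.single_le_sum (f := fun k => |ξ ω k|)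
        (fun _ _ => abs_nonneg _) (Finset.mem_univ k))).trans (hz k)
      simpa using this
    | succ n ih =>
      intro hn ω
      have ht : T - (n + 1) < T := by omega
      have e : T - (n + 1) + 1 = T - n := by omega
      obtain ⟨h1, M, hM⟩ := hWgood _ ht (by rw [e]; exact ih (by omega)) ω
      rw [hZrec _ ht]
      exact ⟨hsum _ _ _ h1, M, fun z hz => ⟨z, hM z hz, 0, hK0 _ _, by simp⟩⟩
  have hZg : ∀ t, t < T → ∀ ω, IsPolyh (𝒵 (t + 1) ω) ∧
      ∃ M : ℝ, ∀ z : Fin d → ℝ, (∀ k, M ≤ z k) → z ∈ 𝒵 (t + 1) ω := by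
    intro t ht ω
    have := hgood (T - (t + 1)) (by omega) ω
    rwa [show T - (T - (t + 1)) = t + 1 by omega] at this
  have hWne : ∀ t, t < T → ∀ ω, (𝒲 t ω).Nonempty := by
    intro t ht ω
    obtain ⟨_, M, hM⟩ := hWgood t ht (hZg t ht) ω
    exact ⟨fun _ => M, hM _ (fun _ => le_rfl)⟩
  refine ⟨?_, ?_, ?_⟩
  · intro ω x
    rw [hZdef, hZT]
    refine ⟨fun h => ?_, fun h => suppF_add_cone_top _ _ _ (Set.singleton_nonempty _) (hKsmul _ _) h⟩
    rw [suppF_add_cone _ _ _ (hK0 _ _) h]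
    apply le_antisymm
    · rw [suppF_neg_le]; rintro z rfl; exact le_rfl
    · exact le_suppF_neg x rfl
  · intro t ht ω x
    obtain ⟨z0, hz0⟩ := hWne t ht ω
    have hmemW : ∀ z, z ∈ 𝒲 t ω ↔ ∀ i ∈ part t ω, z ∈ 𝒵 (t + 1) i := by
      intro z; rw [hW t ht]; simp
    apply le_antisymm
    · apply le_sInf
      rintro _ ⟨lam, xs, hl0, hlp, hl1, hlx, rfl⟩
      rw [hWdef, suppF_neg_le]
      intro z hz
      have : (-(x ⬝ᵥ z)) = ∑ i, lam i * (-(xs i ⬝ᵥ z)) := by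
        rw [← hlx, sum_dotProduct]
        simp [smul_dotProduct]
      rw [this, ereal_coe_sum]
      apply Finset.sum_le_sum
      intro i _
      by_cases hi : i ∈ part t ω
      · rw [EReal.coe_mul, hZdef]
        exact mul_le_mul_of_nonneg_left (le_suppF_neg _ ((hmemW z).1 hz i hi))
          (EReal.coe_nonneg.2 (hl0 i))
      · simp [hlp i hi]
    · by_cases htop : W t ω x = ⊤
      · rw [htop]; exact le_top
      have hbot : W t ω x ≠ ⊥ := by
        intro hb
        have := le_suppF_neg x hz0
        rw [← hWdef, hb] at this
        simp at this
      obtain ⟨c, hc⟩ : ∃ c : ℝ, W t ω x = c := ⟨_, (EReal.coe_toReal htop hbot).symm⟩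
      rw [hc]
      obtain ⟨xs, cs, h1, h2, h3⟩ := inter_decomp (part t ω) (𝒵 (t + 1))
        (fun i _ => (hZg t ht i).1) z0 ((hmemW z0).1 hz0) (-x) c (by
          intro z hz
          have := le_suppF_neg x ((hmemW z).2 hz)
          rw [← hWdef, hc, EReal.coe_le_coe_iff] at this
          simpa [neg_dotProduct] using this)
      have hN : (0 : ℝ) < (part t ω).card := by
        exact_mod_cast Finset.card_pos.2 ⟨ω, hmem t ω⟩
      set N : ℝ := ((part t ω).card : ℝ) with hNdef
      refine le_trans (sInf_le ⟨fun i => if i ∈ part t ω then N⁻¹ else 0, fun i => -(N • xs i), ?_, ?_, ?_, ?_, rfl⟩) ?_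
      · intro i
        dsimp only
        split_ifs
        · positivity
        · exact le_rfl
      · intro i hi; simp [hi]
      · rw [Finset.sum_ite_mem, Finset.univ_inter, Finset.sum_const, nsmul_eq_mul, ← hNdef]
        exact mul_inv_cancel₀ hN.ne'
      · simp only [ite_smul, zero_smul]
        rw [Finset.sum_ite_mem, Finset.univ_inter]
        simp only [smul_neg, smul_smul, inv_mul_cancel₀ hN.ne', one_smul]
        rw [Finset.sum_neg_distrib, h2, neg_neg]
      · refine le_trans ?_ (EReal.coe_le_coe_iff.2 h3)
        have e : ∑ i ∈ part t ω, cs i = ∑ i, if i ∈ part t ω then cs i else 0 := by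
          rw [Finset.sum_ite_mem, Finset.univ_inter]
        rw [e, ereal_coe_sum]
        apply Finset.sum_le_sum
        intro i _
        by_cases hi : i ∈ part t ω
        · simp only [hi, if_true]
          have : Z (t + 1) i (-(N • xs i)) ≤ ((N * cs i : ℝ) : EReal) := by
            rw [hZdef, suppF_neg_le]
            intro z hz
            rw [EReal.coe_le_coe_iff, neg_dotProduct, neg_neg, smul_dotProduct, smul_eq_mul]
            exact mul_le_mul_of_nonneg_left (h1 i hi z hz) hN.le
          refine (mul_le_mul_of_nonneg_left this (EReal.coe_nonneg.2 (by positivity))).trans ?_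
          rw [← EReal.coe_mul, inv_mul_cancel_left₀ hN.ne']
        · simp [hi]
  · intro t ht ω x
    rw [hZdef, hWdef, hZrec t ht]
    exact ⟨fun h => suppF_add_cone _ _ _ (hK0 _ _) h,
      fun h => suppF_add_cone_top _ _ _ (hWne t ht ω) (hKsmul _ _) h⟩
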